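/- arXiv:2411.11198 — 4 statements merged into one kernel-verified Lean document; each statement's English description precedes it below -/
import Mathlib

section
/- (Cauchy theorem, fractional case.) Assume g and h are affine: g(u) = δ₁u + δ₂, h(v) = ρ₁v + ρ₂ with δ₁, ρ₁ > 0, and let f ∈ _{RL}SM^{(α,β)}_{(g,h)}(S_{a,b,c}). Let I ∈ 𝕊 and let γ : [0,1] → int(S_{a,b,c,I}) be a closed piecewise-C¹ curve homotopic to a constant curve within int(S_{a,b,c,I}). Then ∫_0^1 γ′(t) (−I) F_I(γ(t)) dt = 0, where F_I(u + Iv) := (1/δ₁) A_I(u) + (1/ρ₁) B_I(v). -/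
open scoped BigOperators
open Set

noncomputable section

/-- The sphere 𝕊 of (coefficient vectors of) unit 1-vectors in ℝⁿ. -/
def USphere (n : ℕ) : Set (Fin n → ℝ) := {x | ∑ i, x i ^ 2 = 1}

/-- Points of ℝ^{n+1}, written as (x₀, (x₁, …, xₙ)). -/
abbrev Pt (n : ℕ) := ℝ × (Fin n → ℝ)

variable {n : ℕ} {Cl : Type} [NormedRing Cl] [NormedAlgebra ℝ Cl]

/-- The 1-vector of the Clifford algebra with coefficients `x` w.r.t. generators `e`. -/
def vecEmb (e : Fin n → Cl) (x : Fin n → ℝ) : Cl := ∑ i, x i • e i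

/-- The defining relations `eᵢeⱼ + eⱼeᵢ = -2δᵢⱼ` of the Clifford algebra ℝₙ. -/
def CliffordRel (e : Fin n → Cl) : Prop :=
  ∀ i j, e i * e j + e j * e i = if i = j then (-2 : Cl) else 0

/-- The slice Cauchy–Riemann operator `(∂/∂u + I ∂/∂v)` applied to the restriction of `f`
to the slice `ℂ_I`, `I = vecEmb e x`, evaluated at the point `u + I v`. -/
def sliceCR (e : Fin n → Cl) (f : Pt n → Cl) (x : Fin n → ℝ) (u v : ℝ) : Cl :=
  deriv (fun t => f (t, v • x)) u + vecEmb e x * deriv (fun t => f (u, t • x)) v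

/-- λ-slice monogenic functions on `U`. -/
def SMlam (e : Fin n → Cl) (lam : ℝ) (U : Set (Pt n)) (f : Pt n → Cl) : Prop :=
  ContDiffOn ℝ 1 f U ∧
  ∀ x ∈ USphere n, ∀ u v : ℝ, ((u, v • x) : Pt n) ∈ U →
    sliceCR e f x u v + lam • f (u, v • x) = 0

/-- The coordinates (u,v) of the slice `U_I = U ∩ ℂ_I`, `I = vecEmb e x`. -/
def SlicePre (n : ℕ) (U : Set (Pt n)) (x : Fin n → ℝ) : Set (ℝ × ℝ) :=
  {p | ((p.1, p.2 • x) : Pt n) ∈ U}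

/-- Axially symmetric slice domains in ℝ^{n+1}. -/
def AxSymSDomain (n : ℕ) (U : Set (Pt n)) : Prop :=
  IsOpen U ∧ IsConnected U ∧ (∃ u : ℝ, ((u, (0 : Fin n → ℝ)) : Pt n) ∈ U) ∧
  (∀ x ∈ USphere n, IsConnected (SlicePre n U x)) ∧
  ∀ x ∈ USphere n, ∀ y ∈ USphere n, ∀ u v : ℝ,
    ((u, v • x) : Pt n) ∈ U → ((u, v • y) : Pt n) ∈ U

/-- A holomorphic function with values in `ℂ_I`, `I = vecEmb e x`, on a
(relatively open) coordinate set `V`. -/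
def SliceHolo (e : Fin n → Cl) (x : Fin n → ℝ) (V : Set (ℝ × ℝ)) (F : ℝ × ℝ → Cl) : Prop :=
  DifferentiableOn ℝ F V ∧
  (∀ p ∈ V, ∃ a b : ℝ, F p = algebraMap ℝ Cl a + b • vecEmb e x) ∧
  ∀ p ∈ V, deriv (fun t => F (t, p.2)) p.1 + vecEmb e x * deriv (fun t => F (p.1, t)) p.2 = 0

/-- Ordered product `I_A = I_{i₁} ⋯ I_{i_k}` over a finite index set `A`. -/
def IAprod (e : Fin n → Cl) (J : Fin n → Fin n → ℝ) (A : Finset (Fin n)) : Cl :=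
  ((A.sort (· ≤ ·)).map fun i => vecEmb e (J i)).prod

/-- A closed piecewise-C¹ curve parametrized on [0,1]. -/
def PiecewiseC1 (γ : ℝ → ℝ × ℝ) : Prop :=
  ContinuousOn γ (Icc 0 1) ∧
  ∃ (k : ℕ) (t : Fin (k + 1) → ℝ), t 0 = 0 ∧ t (Fin.last k) = 1 ∧ StrictMono t ∧
    ∀ i : Fin k, ContDiffOn ℝ 1 γ (Icc (t i.castSucc) (t i.succ))

/-- `γ` is a closed curve in `V`, homotopic within `V` to a constant curve. -/
def NullHomotopicIn (γ : ℝ → ℝ × ℝ) (V : Set (ℝ × ℝ)) : Prop :=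
  γ 0 = γ 1 ∧ (∀ t ∈ Icc (0:ℝ) 1, γ t ∈ V) ∧
  ∃ (H : ℝ × ℝ → ℝ × ℝ) (p : ℝ × ℝ),
    ContinuousOn H (Icc 0 1 ×ˢ Icc 0 1) ∧
    (∀ q ∈ (Icc (0:ℝ) 1 ×ˢ Icc (0:ℝ) 1), H q ∈ V) ∧
    (∀ t ∈ Icc (0:ℝ) 1, H (0, t) = γ t) ∧
    (∀ t ∈ Icc (0:ℝ) 1, H (1, t) = p) ∧
    (∀ s ∈ Icc (0:ℝ) 1, H (s, 0) = H (s, 1))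

/-- The inverse `(a + bI)⁻¹` computed in the field `ℂ_I`, `I = vecEmb e x`. -/
def sliceInv (e : Fin n → Cl) (x : Fin n → ℝ) (a b : ℝ) : Cl :=
  (a ^ 2 + b ^ 2)⁻¹ • (algebraMap ℝ Cl a - b • vecEmb e x)

/-- The closed Euclidean ball of ℝ^{n+1}. -/
def EucClosedBall (y : Pt n) (ρ : ℝ) : Set (Pt n) :=
  {p | (p.1 - y.1) ^ 2 + ∑ i, (p.2 i - y.2 i) ^ 2 ≤ ρ ^ 2}

/-- Left fractional integral of order `σ` with respect to `g` (with derivative `g'`),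
with base point `aa`. -/
def fracInt (aa σ : ℝ) (g g' : ℝ → ℝ) (φ : ℝ → Cl) (u : ℝ) : Cl :=
  (Real.Gamma σ)⁻¹ • ∫ τ in aa..u, ((g u - g τ) ^ (σ - 1) * g' τ) • φ τ

/-- Right fractional integral of order `σ` with respect to `h` (with derivative `h'`),
with base point `cc`. -/
def fracIntR (cc σ : ℝ) (h h' : ℝ → ℝ) (φ : ℝ → Cl) (v : ℝ) : Cl :=
  (Real.Gamma σ)⁻¹ • ∫ τ in v..cc, ((h τ - h v) ^ (σ - 1) * h' τ) • φ τ

/-- Left Riemann–Liouville fractional derivative of order `al` w.r.t. `g` on `[aa, bb]`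
(one-sided derivatives at the endpoints). -/
def rlD (aa bb al : ℝ) (g g' : ℝ → ℝ) (φ : ℝ → Cl) (u : ℝ) : Cl :=
  (g' u)⁻¹ • derivWithin (fracInt aa (1 - al) g g' φ) (Icc aa bb) u

/-- The set `S_{a,b,c} ⊆ ℝ^{n+1}`. -/
def Sabc (n : ℕ) (a b c : ℝ) : Set (Pt n) :=
  {p | ∃ x ∈ USphere n, ∃ u ∈ Icc a b, ∃ v ∈ Icc 0 c, p = ((u, v • x) : Pt n)}

/-- Absolutely continuous function on `[a,b]`. -/
def AbsContOn {E : Type} [NormedAddCommGroup E] (φ : ℝ → E) (a b : ℝ) : Prop :=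
  ∀ ε > (0:ℝ), ∃ δ > (0:ℝ), ∀ (k : ℕ) (p q : Fin k → ℝ),
    (∀ i, p i ∈ Icc a b ∧ q i ∈ Icc a b ∧ p i ≤ q i) →
    (∀ i j, i ≠ j → Ioo (p i) (q i) ∩ Ioo (p j) (q j) = ∅) →
    (∑ i, (q i - p i)) < δ → (∑ i, ‖φ (q i) - φ (p i)‖) < ε

/-- The class `AC¹(S_{a,b,c}, ℝₙ)`. -/
def AC1 (a b c r s : ℝ) (f : Pt n → Cl) : Prop :=
  ContinuousOn f (Sabc n a b c) ∧
  ∀ x ∈ USphere n,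
    AbsContOn (fun u => f (u, s • x)) a b ∧ AbsContOn (fun v => f (r, v • x)) 0 c

/-- `A_I(u) = (I_{a+}^{1-α,g}[τ ↦ f(τ + Is)])(u)`, where `I = vecEmb e x`. -/
def AIfun (a al s : ℝ) (g g' : ℝ → ℝ) (f : Pt n → Cl) (x : Fin n → ℝ) : ℝ → Cl :=
  fracInt a (1 - al) g g' fun τ => f (τ, s • x)

/-- `B_I(v) = (I_{0+}^{1-β,h}[τ ↦ f(r + Iτ)])(v)`, where `I = vecEmb e x`. -/
def BIfun (be r : ℝ) (h h' : ℝ → ℝ) (f : Pt n → Cl) (x : Fin n → ℝ) : ℝ → Cl :=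
  fracInt 0 (1 - be) h h' fun τ => f (r, τ • x)

/-- `B_I^{c-}(v) = (I_{c-}^{1-β,h}[τ ↦ f(r + Iτ)])(v)`, where `I = vecEmb e x`. -/
def BIcfun (c be r : ℝ) (h h' : ℝ → ℝ) (f : Pt n → Cl) (x : Fin n → ℝ) : ℝ → Cl :=
  fracIntR c (1 - be) h h' fun τ => f (r, τ • x)

/-- Condition (m1): the maps `A_I` and `B_I` are of class C¹ for every `I ∈ 𝕊`. -/
def M1 (a b c al be r s : ℝ) (g g' h h' : ℝ → ℝ) (f : Pt n → Cl) : Prop :=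
  ∀ x ∈ USphere n,
    ContDiffOn ℝ 1 (AIfun a al s g g' f x) (Icc a b) ∧
    ContDiffOn ℝ 1 (BIfun be r h h' f x) (Icc 0 c)

/-- Riemann–Liouville fractional slice monogenic functions of order `(α,β)`
with respect to `(g,h)` on `S_{a,b,c}`. -/
def RLSM (a b c al be r s : ℝ) (g g' h h' : ℝ → ℝ) (e : Fin n → Cl) (f : Pt n → Cl) : Prop :=
  AC1 a b c r s f ∧ M1 a b c al be r s g g' h h' f ∧
  ∀ x ∈ USphere n, ∀ u ∈ Icc a b, ∀ v ∈ Icc 0 c,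
    (g' u)⁻¹ • derivWithin (AIfun a al s g g' f x) (Icc a b) u +
      vecEmb e x * ((h' v)⁻¹ • derivWithin (BIfun be r h h' f x) (Icc 0 c) v) = 0


/-- Unit 1-vectors of a Clifford algebra square to `-1`. -/
theorem CliffordRel.vecEmb_mul_self {e : Fin n → Cl} (he : CliffordRel e) {x : Fin n → ℝ}
    (hx : x ∈ USphere n) : vecEmb e x * vecEmb e x = -1 := by
  have hprod : vecEmb e x * vecEmb e x = ∑ i, ∑ j, (x i * x j) • (e i * e j) := by
    simp only [vecEmb, Finset.sum_mul_sum, smul_mul_smul_comm]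
  have hswap : vecEmb e x * vecEmb e x = ∑ i, ∑ j, (x i * x j) • (e j * e i) := by
    rw [hprod, Finset.sum_comm]
    simp only [mul_comm]
  have hx' : ∑ i, x i * x i = 1 := by
    simpa [USphere, sq] using hx
  have hdouble : (2 : ℝ) • (vecEmb e x * vecEmb e x) = (2 : ℝ) • (-1 : Cl) := by
    calc (2 : ℝ) • (vecEmb e x * vecEmb e x)
        = ∑ i, ∑ j, (x i * x j) • (e i * e j + e j * e i) := by
          simp only [smul_add, Finset.sum_add_distrib]
          rw [← hprod, ← hswap, two_smul]
      _ = ∑ i, (x i * x i) • (-2 : Cl) := by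
          refine Finset.sum_congr rfl fun i _ => ?_
          simp [he i]
      _ = (2 : ℝ) • (-1 : Cl) := by
          rw [← Finset.sum_smul, hx', one_smul, two_smul]
          norm_num
  exact smul_right_injective Cl (two_ne_zero' ℝ) hdouble

/-- A function on `[p, q]` whose derivative is constant is affine. -/
theorem eq_add_smul_of_derivWithin_eq {E : Type*} [NormedAddCommGroup E] [NormedSpace ℝ E]
    {φ : ℝ → E} {p q : ℝ} {C : E} (hφ : DifferentiableOn ℝ φ (Icc p q))
    (hC : ∀ u ∈ Icc p q, derivWithin φ (Icc p q) u = C) {u : ℝ} (hu : u ∈ Icc p q) :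
    φ u = φ p + (u - p) • C := by
  have hderiv : ∀ y ∈ Icc p q,
      HasDerivWithinAt (fun y => φ y - (y - p) • C) 0 (Icc p q) y := fun y hy => by
    have h1 := (hφ y hy).hasDerivWithinAt
    rw [hC y hy] at h1
    simpa using h1.fun_sub ((((hasDerivAt_id' y).sub_const p).smul_const C).hasDerivWithinAt)
  have hconst := constant_of_has_deriv_right_zero
    (fun y hy => (hderiv y hy).continuousWithinAt)
    (fun y hy => (hderiv y (Ico_subset_Icc_self hy)).mono_of_mem_nhdsWithin
      (Icc_mem_nhdsGE_of_mem hy)) u hu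
  simpa [sub_eq_iff_eq_add] using hconst

/-- The fundamental theorem of calculus on one `C¹` piece. -/
theorem integral_eq_sub_of_contDiffOn_Icc {E : Type*} [NormedAddCommGroup E] [NormedSpace ℝ E]
    [CompleteSpace E] {P φ : ℝ → E} {p q : ℝ} (hpq : p < q) (hP : ContDiffOn ℝ 1 P (Icc p q))
    (hφ : ∀ t ∈ Ioo p q, HasDerivAt P (φ t) t) :
    IntervalIntegrable φ MeasureTheory.volume p q ∧ ∫ t in p..q, φ t = P q - P p := by
  have hcont := hP.continuousOn_derivWithin (uniqueDiffOn_Icc hpq) le_rfl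
  have hint : IntervalIntegrable φ MeasureTheory.volume p q := by
    refine (ContinuousOn.intervalIntegrable_of_Icc hpq.le hcont).congr_uIoo fun t ht => ?_
    rw [uIoo_of_le hpq.le] at ht
    exact (derivWithin_of_mem_nhds (Icc_mem_nhds ht.1 ht.2)).trans (hφ t ht).deriv
  exact ⟨hint, intervalIntegral.integral_eq_sub_of_hasDerivAt_of_le hpq.le hP.continuousOn hφ hint⟩

/-- The fundamental theorem of calculus for a `C¹` function along a piecewise `C¹` curve. -/
theorem PiecewiseC1.integral_eq_sub {γ : ℝ → ℝ × ℝ} (hγ : PiecewiseC1 γ)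
    {E : Type*} [NormedAddCommGroup E] [NormedSpace ℝ E] [CompleteSpace E]
    {G : ℝ × ℝ → E} (hG : ContDiff ℝ 1 G) {φ : ℝ → E}
    (hφ : ∀ t ∈ Ioo (0 : ℝ) 1, DifferentiableAt ℝ γ t → HasDerivAt (G ∘ γ) (φ t) t) :
    ∫ t in (0 : ℝ)..1, φ t = G (γ 1) - G (γ 0) := by
  obtain ⟨-, k, t, ht0, ht1, hmono, hdiff⟩ := hγ
  have hpiece (i : Fin k) := integral_eq_sub_of_contDiffOn_Icc (P := G ∘ γ) (φ := φ)
    (hmono i.castSucc_lt_succ) (hG.comp_contDiffOn (hdiff i)) fun y hy => by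
      have h0 : 0 ≤ t i.castSucc := ht0 ▸ hmono.monotone (Fin.zero_le _)
      have h1 : t i.succ ≤ 1 := ht1 ▸ hmono.monotone (Fin.le_last _)
      exact hφ y ⟨h0.trans_lt hy.1, hy.2.trans_le h1⟩ (((hdiff i).differentiableOn one_ne_zero
        y (Ioo_subset_Icc_self hy)).differentiableAt (Icc_mem_nhds hy.1 hy.2))
  have hall (i : Fin (k + 1)) : IntervalIntegrable φ MeasureTheory.volume 0 (t i) ∧
      ∫ y in (0 : ℝ)..(t i), φ y = G (γ (t i)) - G (γ 0) := by
    induction i using Fin.induction with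
    | zero => simp [ht0]
    | succ i ih =>
      refine ⟨ih.1.trans (hpiece i).1, ?_⟩
      rw [← intervalIntegral.integral_add_adjacent_intervals ih.1 (hpiece i).1, ih.2, (hpiece i).2]
      simp
  simpa [ht1] using (hall (Fin.last k)).2

/-- Cauchy's theorem for left-affine functions `z ↦ K + z * C` on a plane `ℝ + ℝJ`. -/
theorem PiecewiseC1.integral_mul_affine_eq_zero [CompleteSpace Cl] {γ : ℝ → ℝ × ℝ}
    (hγ : PiecewiseC1 γ) (hclosed : γ 0 = γ 1) (J K C : Cl) :
    ∫ t in (0 : ℝ)..1, ((deriv γ t).1 • (1 : Cl) + (deriv γ t).2 • J) * (-J) *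
      (K + ((γ t).1 • (1 : Cl) + (γ t).2 • J) * C) = 0 := by
  let z : ℝ × ℝ → Cl := fun p => p.1 • (1 : Cl) + p.2 • J
  have hz : ContDiff ℝ 1 z := by fun_prop
  have hcomm (p q : ℝ × ℝ) : z p * z q = z q * z p := by
    simp only [z, add_mul, mul_add, smul_mul_smul_comm, one_mul, mul_one, mul_comm q.1, mul_comm q.2]
    abel
  have hcommJ (p : ℝ × ℝ) : z p * J = J * z p := by
    simp [z, add_mul, mul_add]
  have hprim := hγ.integral_eq_sub
    (G := fun p => -J * (z p * K + (1 / 2 : ℝ) • (z p * z p * C)))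
    (φ := fun t => z (deriv γ t) * (-J) * (K + z (γ t) * C)) (by fun_prop) fun t _ ht => by
      have hγt := ht.hasDerivAt
      have hzt : HasDerivAt (fun y => z (γ y)) (z (deriv γ t)) t :=
        (HasDerivAt.smul_const (hasFDerivAt_fst.comp_hasDerivAt t hγt) (1 : Cl)).add
          (HasDerivAt.smul_const (hasFDerivAt_snd.comp_hasDerivAt t hγt) J)
      refine (((hzt.mul_const K).add
        (((hzt.mul hzt).mul_const C).const_smul (1 / 2 : ℝ))).const_mul (-J)).congr_deriv ?_
      rw [hcomm (γ t), ← two_smul ℝ, smul_mul_assoc, smul_smul]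
      norm_num
      rw [hcommJ]
      simp only [mul_assoc, mul_add]
  rw [hclosed, sub_self] at hprim
  exact hprim

/-- Cauchy theorem for `F_I(u+Iv) = (1/δ₁)A_I(u) + (1/ρ₁)B_I(v)`,
fractional case with affine `g`, `h`. -/
theorem statement14 [CompleteSpace Cl] (e : Fin n → Cl) (he : CliffordRel e)
    (a b c r s al be δ₁ δ₂ ρ₁ ρ₂ : ℝ)
    (hab : a < b) (hc : 0 < c) (hr : r ∈ Icc a b) (hs : s ∈ Icc 0 c)
    (hal : al ∈ Ioo (0:ℝ) 1) (hbe : be ∈ Ioo (0:ℝ) 1)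
    (hδ : 0 < δ₁) (hρ : 0 < ρ₁)
    (f : Pt n → Cl)
    (hf : RLSM a b c al be r s (fun u => δ₁ * u + δ₂) (fun _ => δ₁)
      (fun v => ρ₁ * v + ρ₂) (fun _ => ρ₁) e f)
    (x : Fin n → ℝ) (hx : x ∈ USphere n)
    (γ : ℝ → ℝ × ℝ) (hγ : PiecewiseC1 γ)
    (hγ0 : NullHomotopicIn γ (Ioo a b ×ˢ Ioo 0 c)) :
    ∫ t in (0:ℝ)..1,
      ((deriv γ t).1 • (1 : Cl) + (deriv γ t).2 • vecEmb e x) *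
        (-(vecEmb e x)) *
        (δ₁⁻¹ • AIfun a al s (fun u => δ₁ * u + δ₂) (fun _ => δ₁) f x (γ t).1
          + ρ₁⁻¹ • BIfun be r (fun v => ρ₁ * v + ρ₂) (fun _ => ρ₁) f x (γ t).2) = 0 := by
  obtain ⟨-, hm1, hCR⟩ := hf
  obtain ⟨hA, hB⟩ := hm1 x hx
  specialize hCR x hx
  have hJJ := he.vecEmb_mul_self hx
  obtain ⟨hclosed, hmem, -⟩ := hγ0
  set J := vecEmb e x
  set A := AIfun a al s (fun u => δ₁ * u + δ₂) (fun _ => δ₁) f x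
  set B := BIfun be r (fun v => ρ₁ * v + ρ₂) (fun _ => ρ₁) f x
  have ha : a ∈ Icc a b := left_mem_Icc.2 hab.le
  have h0 : (0 : ℝ) ∈ Icc 0 c := left_mem_Icc.2 hc.le
  set C : Cl := δ₁⁻¹ • derivWithin A (Icc a b) a with hCdef
  have hB' : ∀ v ∈ Icc 0 c, derivWithin B (Icc 0 c) v = ρ₁ • (J * C) := fun v hv => by
    have h := congrArg (J * ·) (hCR a ha v hv)
    simp only [mul_add, mul_zero, ← mul_assoc, hJJ, neg_mul, one_mul] at h
    rw [hCdef, add_neg_eq_zero.1 h, smul_inv_smul₀ hρ.ne']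
  have hA' : ∀ u ∈ Icc a b, derivWithin A (Icc a b) u = δ₁ • C := fun u hu => by
    rw [hCdef, add_right_cancel ((hCR a ha 0 h0).trans (hCR u hu 0 h0).symm),
      smul_inv_smul₀ hδ.ne']
  have hF : ∀ t ∈ Icc (0 : ℝ) 1, δ₁⁻¹ • A (γ t).1 + ρ₁⁻¹ • B (γ t).2 =
      (δ₁⁻¹ • A a + ρ₁⁻¹ • B 0 - a • C) + ((γ t).1 • (1 : Cl) + (γ t).2 • J) * C := fun t ht => by
    obtain ⟨hu, hv⟩ := hmem t ht
    rw [eq_add_smul_of_derivWithin_eq (hA.differentiableOn one_ne_zero) hA'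
        (Ioo_subset_Icc_self hu),
      eq_add_smul_of_derivWithin_eq (hB.differentiableOn one_ne_zero) hB'
        (Ioo_subset_Icc_self hv), smul_add, smul_add, smul_comm δ₁⁻¹, smul_comm ρ₁⁻¹,
      inv_smul_smul₀ hδ.ne', inv_smul_smul₀ hρ.ne', add_mul, smul_mul_assoc, smul_mul_assoc,
      one_mul, sub_smul, sub_zero]
    abel
  rw [← hγ.integral_mul_affine_eq_zero hclosed J (δ₁⁻¹ • A a + ρ₁⁻¹ • B 0 - a • C) C]
  refine intervalIntegral.integral_congr fun t ht => ?_
  rw [uIcc_of_le zero_le_one] at ht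
  simp only [hF t ht]
end
end

section
/- (Relation between Caputo and Riemann–Liouville slice fractional derivatives.) Let f ∈ AC¹(S_{a,b,c}, ℝ_n) satisfy condition (m1), let I ∈ 𝕊, and define ℋ(f)(u+Iv, r, s) := A_I(u) + B_I(v) and G_I(u + Iv) := (_{RL}D_{a+}^{α,g}[τ ↦ f(τ + Is)])(u) + I (_{RL}D_{0+}^{β,h}[τ ↦ f(r + Iτ)])(v). Then for every u ∈ [a,b] and v ∈ [0,c]: (_C D_{a+}^{α,g}[t ↦ ℋ(f)(t + Iv, r, s)])(u) + I (_C D_{0+}^{β,h}[t ↦ ℋ(f)(u + It, r, s)])(v) = (I_{a+}^{1−α,g}[τ ↦ G_I(τ + Is)])(u) + (I_{0+}^{1−β,h}[τ ↦ G_I(r + Iτ)])(v) − (I_{0+}^{1−β,h}1)(v) · (_{RL}D_{a+}^{α,g}[τ ↦ f(τ + Is)])(r) − (I_{a+}^{1−α,g}1)(u) · I · (_{RL}D_{0+}^{β,h}[τ ↦ f(r + Iτ)])(s), where 1 denotes the constant function with value 1. -/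
open scoped BigOperators
open Set

noncomputable section

variable {n : ℕ} {Cl : Type} [NormedRing Cl] [NormedAlgebra ℝ Cl]

/-- The kernel of a left fractional integral of positive order is integrable. -/
theorem intervalIntegrable_fracInt_kernel {p q σ u : ℝ} {g g' : ℝ → ℝ} (hσ : 0 < σ)
    (hg : ∀ t ∈ Icc p q, HasDerivWithinAt g (g' t) (Icc p q) t)
    (hpos : ∀ t ∈ Icc p q, 0 < g' t) (hu : u ∈ Icc p q) :
    IntervalIntegrable (fun τ => (g u - g τ) ^ (σ - 1) * g' τ) MeasureTheory.volume p u := by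
  have hsub : Icc p u ⊆ Icc p q := Icc_subset_Icc_right hu.2
  have hcont : ContinuousOn g (Icc p q) := fun t ht => (hg t ht).continuousWithinAt
  have hmono : StrictMonoOn g (Icc p q) :=
    strictMonoOn_of_hasDerivWithinAt_pos (convex_Icc p q) hcont
      (fun t ht => (hg t (interior_subset ht)).mono interior_subset)
      (fun t ht => hpos t (interior_subset ht))
  have hlt : ∀ t ∈ Ioo p u, 0 < g u - g t := fun t ht =>
    sub_pos.2 (hmono (hsub (Ioo_subset_Icc_self ht)) hu ht.2)
  refine intervalIntegral.intervalIntegrable_deriv_of_nonneg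
    (g := fun τ => -((g u - g τ) ^ σ / σ)) ?_ ?_ ?_
  · rw [uIcc_of_le hu.1]
    exact ((((continuousOn_const.sub (hcont.mono hsub)).rpow_const
      fun _ _ => Or.inr hσ.le)).div_const σ).neg
  · rw [min_eq_left hu.1, max_eq_right hu.1]
    intro t ht
    have hgt : HasDerivAt g (g' t) t :=
      (hg t (hsub (Ioo_subset_Icc_self ht))).hasDerivAt
        (Icc_mem_nhds ht.1 (ht.2.trans_le hu.2))
    refine (((hgt.const_sub (g u)).rpow_const
      (p := σ) (Or.inl (hlt t ht).ne')).div_const σ).neg.congr_deriv ?_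
    have hσ' := hσ.ne'
    field_simp
  · rw [min_eq_left hu.1, max_eq_right hu.1]
    intro t ht
    exact mul_nonneg (Real.rpow_nonneg (hlt t ht).le _)
      (hpos t (hsub (Ioo_subset_Icc_self ht))).le

theorem fracInt_add {p σ u : ℝ} {g g' : ℝ → ℝ} {φ ψ : ℝ → Cl}
    (hK : IntervalIntegrable (fun τ => (g u - g τ) ^ (σ - 1) * g' τ) MeasureTheory.volume p u)
    (hφ : ContinuousOn φ (uIcc p u)) (hψ : ContinuousOn ψ (uIcc p u)) :
    fracInt p σ g g' (fun τ => φ τ + ψ τ) u = fracInt p σ g g' φ u + fracInt p σ g g' ψ u := by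
  simp only [fracInt, smul_add]
  rw [intervalIntegral.integral_add (hK.smul_continuousOn hφ) (hK.smul_continuousOn hψ), smul_add]

theorem fracInt_const_mul [CompleteSpace Cl] {p σ u : ℝ} {g g' : ℝ → ℝ} {φ : ℝ → Cl}
    (hK : IntervalIntegrable (fun τ => (g u - g τ) ^ (σ - 1) * g' τ) MeasureTheory.volume p u)
    (hφ : ContinuousOn φ (uIcc p u)) (k : Cl) :
    fracInt p σ g g' (fun τ => k * φ τ) u = k * fracInt p σ g g' φ u := by
  have := (ContinuousLinearMap.mul ℝ Cl k).intervalIntegral_comp_comm (hK.smul_continuousOn hφ)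
  simp only [ContinuousLinearMap.mul_apply', mul_smul_comm] at this
  simp only [fracInt, this, mul_smul_comm]

theorem fracInt_const [CompleteSpace Cl] (p σ u : ℝ) (g g' : ℝ → ℝ) (k : Cl) :
    fracInt p σ g g' (fun _ => k) u = fracInt p σ g g' (fun _ => (1 : Cl)) u * k := by
  simp only [fracInt, intervalIntegral.integral_smul_const, smul_mul_assoc, one_mul]

theorem continuousOn_rlD {p q al : ℝ} (hpq : p < q) {g g' : ℝ → ℝ} {φ : ℝ → Cl}
    (hg' : ContinuousOn g' (Icc p q)) (hpos : ∀ t ∈ Icc p q, 0 < g' t)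
    (hφ : ContDiffOn ℝ 1 (fracInt p (1 - al) g g' φ) (Icc p q)) :
    ContinuousOn (rlD p q al g g' φ) (Icc p q) :=
  (hg'.inv₀ fun t ht => (hpos t ht).ne').smul
    (hφ.continuousOn_derivWithin (uniqueDiffOn_Icc hpq) le_rfl)

/-- Relation between the Caputo and Riemann–Liouville slice fractional
derivatives applied to `ℋ(f)(u+Iv,r,s) = A_I(u) + B_I(v)`. -/
theorem statement17 [CompleteSpace Cl] (e : Fin n → Cl) (he : CliffordRel e)
    (a b c r s al be : ℝ)
    (hab : a < b) (hc : 0 < c) (hr : r ∈ Icc a b) (hs : s ∈ Icc 0 c)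
    (hal : al ∈ Ioo (0:ℝ) 1) (hbe : be ∈ Ioo (0:ℝ) 1)
    (g g' h h' : ℝ → ℝ)
    (hg1 : ∀ t ∈ Icc a b, HasDerivWithinAt g (g' t) (Icc a b) t)
    (hg2 : ContinuousOn g' (Icc a b))
    (hgpos : ∀ t ∈ Icc a b, 0 < g' t)
    (hh1 : ∀ t ∈ Icc 0 c, HasDerivWithinAt h (h' t) (Icc 0 c) t)
    (hh2 : ContinuousOn h' (Icc 0 c))
    (hhpos : ∀ t ∈ Icc 0 c, 0 < h' t)
    (f : Pt n → Cl) (hf : AC1 a b c r s f) (hm1 : M1 a b c al be r s g g' h h' f)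
    (x : Fin n → ℝ) (hx : x ∈ USphere n)
    (u : ℝ) (hu : u ∈ Icc a b) (v : ℝ) (hv : v ∈ Icc 0 c) :
    fracInt a (1 - al) g g' (fun τ => (g' τ)⁻¹ •
        derivWithin (fun t => AIfun a al s g g' f x t + BIfun be r h h' f x v)
          (Icc a b) τ) u
      + vecEmb e x * fracInt 0 (1 - be) h h' (fun τ => (h' τ)⁻¹ •
        derivWithin (fun t => AIfun a al s g g' f x u + BIfun be r h h' f x t)
          (Icc 0 c) τ) v
    = fracInt a (1 - al) g g' (fun τ =>
          rlD a b al g g' (fun t => f (t, s • x)) τ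
            + vecEmb e x * rlD 0 c be h h' (fun t => f (r, t • x)) s) u
      + fracInt 0 (1 - be) h h' (fun τ =>
          rlD a b al g g' (fun t => f (t, s • x)) r
            + vecEmb e x * rlD 0 c be h h' (fun t => f (r, t • x)) τ) v
      - fracInt 0 (1 - be) h h' (fun _ => (1 : Cl)) v *
          rlD a b al g g' (fun t => f (t, s • x)) r
      - fracInt a (1 - al) g g' (fun _ => (1 : Cl)) u *
          (vecEmb e x * rlD 0 c be h h' (fun t => f (r, t • x)) s) := by
  have hKg := intervalIntegrable_fracInt_kernel (sub_pos.2 hal.2) hg1 hgpos hu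
  have hKh := intervalIntegrable_fracInt_kernel (sub_pos.2 hbe.2) hh1 hhpos hv
  have hA : ContinuousOn (rlD a b al g g' fun t => f (t, s • x)) (uIcc a u) :=
    (continuousOn_rlD hab hg2 hgpos (hm1 x hx).1).mono
      (by rw [uIcc_of_le hu.1]; exact Icc_subset_Icc_right hu.2)
  have hB : ContinuousOn (rlD 0 c be h h' fun t => f (r, t • x)) (uIcc 0 v) :=
    (continuousOn_rlD hc hh2 hhpos (hm1 x hx).2).mono
      (by rw [uIcc_of_le hv.1]; exact Icc_subset_Icc_right hv.2)
  rw [fracInt_add hKg hA continuousOn_const,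
    fracInt_add hKh continuousOn_const
      (ψ := fun τ => vecEmb e x * rlD 0 c be h h' (fun t => f (r, t • x)) τ)
      (continuousOn_const.mul hB),
    fracInt_const_mul hKh hB, fracInt_const a,
    fracInt_const 0 _ _ _ _ (rlD a b al g g' (fun t => f (t, s • x)) r)]
  simp only [derivWithin_add_const, derivWithin_const_add]
  change fracInt a (1 - al) g g' (rlD a b al g g' fun t => f (t, s • x)) u +
    vecEmb e x * fracInt 0 (1 - be) h h' (rlD 0 c be h h' fun t => f (r, t • x)) v = _
  abel
end
end

section
/- Let λ ∈ ℝ and assume g ∈ C²([a,b], ℝ) with g′ > 0 and g″ + 2λg′ = 0, and h ∈ C²([0,c], ℝ) with h′ > 0 and h″ + 2λh′ = 0. Let f ∈ AC¹(S_{a,b,c}, ℝ_n) be such that A_I and B_I^{c−} are of class C¹ for every I ∈ 𝕊, and let I ∈ 𝕊. Then for every u ∈ (a,b) and v ∈ (0,c): (∂/∂u + I ∂/∂v)[ (1/g′(u)) A_I(u) + (1/h′(v)) B_I^{c−}(v) ] = 2λ [ (1/g′(u)) A_I(u) + I (1/h′(v)) B_I^{c−}(v) ] + (1/g′(u)) A_I′(u)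 + I (1/h′(v)) (B_I^{c−})′(v), the last two summands being the mixed slice Riemann–Liouville fractional derivative (_{RL}D_{a+c−,I}^{(α,β),(g,h)} f)(u+Iv, r, s). -/
open scoped BigOperators
open Set

noncomputable section

variable {n : ℕ} {Cl : Type} [NormedRing Cl] [NormedAlgebra ℝ Cl]

/-- Derivative of `A / p` at an interior point of an interval when the derivative of `p` there is
`-2 * lam * p`. -/
theorem hasDerivAt_inv_smul_of_ode {E : Type*} [NormedAddCommGroup E] [NormedSpace ℝ E]
    {lam a b t d : ℝ} {p : ℝ → ℝ} {A : ℝ → E} (ht : t ∈ Ioo a b)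
    (hp : HasDerivWithinAt p d (Icc a b) t) (hpos : 0 < p t) (hode : d + 2 * lam * p t = 0)
    (hA : ContDiffOn ℝ 1 A (Icc a b)) :
    HasDerivAt (fun y => (p y)⁻¹ • A y)
      ((2 * lam) • ((p t)⁻¹ • A t) + (p t)⁻¹ • deriv A t) t := by
  have hnhds : Icc a b ∈ nhds t := Icc_mem_nhds ht.1 ht.2
  have hA' : HasDerivAt A (deriv A t) t :=
    ((hA.contDiffAt hnhds).differentiableAt one_ne_zero).hasDerivAt
  refine (((hp.hasDerivAt hnhds).fun_inv hpos.ne').fun_smul hA').congr_deriv ?_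
  have hcoef : -d / p t ^ 2 = 2 * lam * (p t)⁻¹ := by
    have := hpos.ne'
    field_simp
    linear_combination -hode
  rw [hcoef, mul_smul, add_comm]

/-- the analogue of Statement 8 for the mixed operator built from
`A_I` and `B_I^{c-}`, when `g″ + 2λg′ = 0` and `h″ + 2λh′ = 0`. -/
theorem statement18 [CompleteSpace Cl] (e : Fin n → Cl) (he : CliffordRel e)
    (lam a b c r s al be : ℝ)
    (hab : a < b) (hc : 0 < c) (hr : r ∈ Icc a b) (hs : s ∈ Icc 0 c)
    (hal : al ∈ Ioo (0:ℝ) 1) (hbe : be ∈ Ioo (0:ℝ) 1)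
    (g g' g'' h h' h'' : ℝ → ℝ)
    (hg1 : ∀ t ∈ Icc a b, HasDerivWithinAt g (g' t) (Icc a b) t)
    (hg2 : ∀ t ∈ Icc a b, HasDerivWithinAt g' (g'' t) (Icc a b) t)
    (hg3 : ContinuousOn g'' (Icc a b))
    (hgpos : ∀ t ∈ Icc a b, 0 < g' t)
    (hgode : ∀ t ∈ Icc a b, g'' t + 2 * lam * g' t = 0)
    (hh1 : ∀ t ∈ Icc 0 c, HasDerivWithinAt h (h' t) (Icc 0 c) t)
    (hh2 : ∀ t ∈ Icc 0 c, HasDerivWithinAt h' (h'' t) (Icc 0 c) t)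
    (hh3 : ContinuousOn h'' (Icc 0 c))
    (hhpos : ∀ t ∈ Icc 0 c, 0 < h' t)
    (hhode : ∀ t ∈ Icc 0 c, h'' t + 2 * lam * h' t = 0)
    (f : Pt n → Cl) (hf : AC1 a b c r s f)
    (hm : ∀ y ∈ USphere n,
      ContDiffOn ℝ 1 (AIfun a al s g g' f y) (Icc a b) ∧
      ContDiffOn ℝ 1 (BIcfun c be r h h' f y) (Icc 0 c))
    (x : Fin n → ℝ) (hx : x ∈ USphere n)
    (u v : ℝ) (hu : u ∈ Ioo a b) (hv : v ∈ Ioo 0 c) :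
    deriv (fun t => (g' t)⁻¹ • AIfun a al s g g' f x t
        + (h' v)⁻¹ • BIcfun c be r h h' f x v) u
      + vecEmb e x * deriv (fun t => (g' u)⁻¹ • AIfun a al s g g' f x u
        + (h' t)⁻¹ • BIcfun c be r h h' f x t) v
    = (2 * lam) • ((g' u)⁻¹ • AIfun a al s g g' f x u
        + vecEmb e x * ((h' v)⁻¹ • BIcfun c be r h h' f x v))
      + ((g' u)⁻¹ • deriv (AIfun a al s g g' f x) u
        + vecEmb e x * ((h' v)⁻¹ • deriv (BIcfun c be r h h' f x) v)) := by
  obtain ⟨hA, hB⟩ := hm x hx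
  have hu' := Ioo_subset_Icc_self hu
  have hv' := Ioo_subset_Icc_self hv
  rw [((hasDerivAt_inv_smul_of_ode hu (hg2 u hu') (hgpos u hu') (hgode u hu') hA).add_const
      _).deriv,
    ((hasDerivAt_inv_smul_of_ode hv (hh2 v hv') (hhpos v hv') (hhode v hv') hB).const_add
      _).deriv,
    mul_add, mul_smul_comm (2 * lam), smul_add]
  abel
end
end

section
/- (Fundamental theorem of Riemann–Liouville fractional calculus with respect to a function.) Let a < b, α ∈ (0,1), let g ∈ C¹([a,b], ℝ) with g′ > 0, and let f : [a,b] → ℝ be continuous. Then for every x ∈ (a,b], the function u ↦ (I_{a+}^{1−α,g}(I_{a+}^{α,g}f))(u) is differentiable at x and (_{RL}D_{a+}^{α,g}(I_{a+}^{α,g}f))(x) = f(x). -/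
open scoped BigOperators
open Set

noncomputable section

variable {n : ℕ} {Cl : Type} [NormedRing Cl] [NormedAlgebra ℝ Cl]

open MeasureTheory ProbabilityTheory in
/-- The beta integral over the reals. -/
theorem integral_rpow_mul_one_sub_rpow {p q : ℝ} (hp : 0 < p) (hq : 0 < q) :
    ∫ y in Ioo (0:ℝ) 1, y ^ (p - 1) * (1 - y) ^ (q - 1) = beta p q := by
  rw [beta_eq_betaIntegralReal p q hp hq, Complex.betaIntegral,
    intervalIntegral.integral_of_le (by norm_num), ← integral_Ioc_eq_integral_Ioo,
    ← RCLike.re_to_complex, ← integral_re]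
  · refine setIntegral_congr_fun measurableSet_Ioc fun y ⟨hy1, hy2⟩ ↦ ?_
    norm_cast
    rw [← Complex.ofReal_cpow, ← Complex.ofReal_cpow, RCLike.re_to_complex,
      Complex.re_mul_ofReal, Complex.ofReal_re]
    all_goals linarith
  · exact (intervalIntegrable_iff_integrableOn_Ioc_of_le zero_le_one).1
      (Complex.betaIntegral_convergent (u := p) (v := q) (by simpa) (by simpa))

open MeasureTheory in
/-- The beta integral with respect to an increasing function `g` on `[s, x]`. -/
theorem integral_rpow_sub_mul_rpow_sub {s x al : ℝ} {g g' : ℝ → ℝ} (hsx : s < x)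
    (hal : al ∈ Ioo (0:ℝ) 1) (hg : ∀ t ∈ Icc s x, HasDerivWithinAt g (g' t) (Icc s x) t)
    (hmono : StrictMonoOn g (Icc s x)) (hpos : ∀ t ∈ Icc s x, 0 < g' t) :
    ∫ t in Ioo s x, (g x - g t) ^ (1 - al - 1) * g' t * (g t - g s) ^ (al - 1) =
      Real.Gamma al * Real.Gamma (1 - al) := by
  have hs : s ∈ Icc s x := left_mem_Icc.2 hsx.le
  have hx : x ∈ Icc s x := right_mem_Icc.2 hsx.le
  have hd : 0 < g x - g s := sub_pos.2 (hmono hs hx hsx)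
  have hφ : ∀ t ∈ Icc s x,
      HasDerivWithinAt (fun t ↦ (g t - g s) / (g x - g s)) (g' t / (g x - g s)) (Icc s x) t :=
    fun t ht ↦ ((hg t ht).sub_const _).div_const _
  have hφm : StrictMonoOn (fun t ↦ (g t - g s) / (g x - g s)) (Icc s x) := fun u hu v hv huv ↦ by
    have := hmono hu hv huv
    dsimp only
    gcongr
  have himg := ContinuousOn.image_Ioo_of_strictMonoOn hsx.le
    (fun t ht ↦ (hφ t ht).continuousWithinAt) hφm
  simp only [sub_self, zero_div, div_self hd.ne'] at himg
  have key := integral_rpow_mul_one_sub_rpow hal.1 (sub_pos.2 hal.2)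
  rw [← himg, integral_image_eq_integral_abs_deriv_smul measurableSet_Ioo
    (fun t ht ↦ (hφ t (Ioo_subset_Icc_self ht)).mono Ioo_subset_Icc_self)
    (hφm.injOn.mono Ioo_subset_Icc_self)] at key
  rw [ProbabilityTheory.beta, add_sub_cancel, Real.Gamma_one, div_one] at key
  rw [← key]
  refine setIntegral_congr_fun measurableSet_Ioo fun t ht ↦ ?_
  have ht' := Ioo_subset_Icc_self ht
  have h1 : 0 < g t - g s := sub_pos.2 (hmono hs ht' ht.1)
  have h2 : 0 < g x - g t := sub_pos.2 (hmono ht' hx ht.2)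
  have h3 : 1 - (g t - g s) / (g x - g s) = (g x - g t) / (g x - g s) := by
    field_simp
    ring
  have h4 : (g x - g s) * ((g x - g s) ^ (al - 1) * (g x - g s) ^ (1 - al - 1)) = 1 := by
    rw [← Real.rpow_add hd, mul_comm, ← Real.rpow_add_one hd.ne',
      show al - 1 + (1 - al - 1) + 1 = 0 by ring, Real.rpow_zero]
  simp only [smul_eq_mul]
  rw [h3, abs_of_pos (div_pos (hpos t ht') hd), Real.div_rpow h1.le hd.le,
    Real.div_rpow h2.le hd.le, div_mul_div_comm, div_mul_div_comm, h4]
  ring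

open MeasureTheory in
/-- Fractional integrals of complementary orders compose to the ordinary integral. -/
theorem fracInt_one_sub_fracInt {a x al : ℝ} {g g' f : ℝ → ℝ} (hax : a ≤ x)
    (hal : al ∈ Ioo (0:ℝ) 1) (hg : ∀ t ∈ Icc a x, HasDerivWithinAt g (g' t) (Icc a x) t)
    (hg' : ContinuousOn g' (Icc a x)) (hpos : ∀ t ∈ Icc a x, 0 < g' t)
    (hf : ContinuousOn f (Icc a x)) :
    fracInt a (1 - al) g g' (fracInt a al g g' f) x = ∫ t in a..x, g' t * f t := by
  have hgc : ContinuousOn g (Icc a x) := fun t ht ↦ (hg t ht).continuousWithinAt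
  have hmono : StrictMonoOn g (Icc a x) := by
    refine strictMonoOn_of_hasDerivWithinAt_pos (convex_Icc a x) hgc
      (fun t ht ↦ (hg t (interior_subset ht)).mono interior_subset)
      (fun t ht ↦ hpos t (interior_subset ht))
  set μ : Measure ℝ := volume.restrict (Ioo a x)
  have hΓ1 := (Real.Gamma_pos_of_pos hal.1).ne'
  have hΓ2 := (Real.Gamma_pos_of_pos (sub_pos.2 hal.2)).ne'
  set B : ℝ := Real.Gamma al * Real.Gamma (1 - al) with hB
  let k : ℝ → ℝ → ℝ := fun t s ↦
    if s < t then (g x - g t) ^ (1 - al - 1) * g' t * (g t - g s) ^ (al - 1) else 0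
  have hk_ind : ∀ t s, k t s = (Ioi s).indicator
      (fun t ↦ (g x - g t) ^ (1 - al - 1) * g' t * (g t - g s) ^ (al - 1)) t := fun t s ↦ rfl
  have hk_nonneg : ∀ s ∈ Ioo a x, ∀ t ∈ Ioo a x, 0 ≤ k t s := by
    intro s hs t ht
    simp only [k]
    split_ifs with hst
    · have h1 := hmono (Ioo_subset_Icc_self hs) (Ioo_subset_Icc_self ht) hst
      have h2 := hmono (Ioo_subset_Icc_self ht) (right_mem_Icc.2 hax) ht.2
      exact mul_nonneg (mul_nonneg (Real.rpow_nonneg (by linarith) _)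
        (hpos t (Ioo_subset_Icc_self ht)).le) (Real.rpow_nonneg (by linarith) _)
    · exact le_rfl
  have hk_int : ∀ s ∈ Ioo a x, ∫ t, k t s ∂μ = B := by
    intro s hs
    have hsub : Icc s x ⊆ Icc a x := Icc_subset_Icc_left hs.1.le
    simp only [hk_ind, μ]
    rw [setIntegral_indicator measurableSet_Ioi,
      show Ioo a x ∩ Ioi s = Ioo s x by ext t; simp; grind [hs.1]]
    exact integral_rpow_sub_mul_rpow_sub hs.2 hal
      (fun t ht ↦ (hg t (hsub ht)).mono hsub) (hmono.mono hsub) (fun t ht ↦ hpos t (hsub ht))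
  have hk_integrable : ∀ s ∈ Ioo a x, Integrable (fun t ↦ k t s) μ := by
    intro s hs
    refine Integrable.of_integral_ne_zero ?_
    rw [hk_int s hs]
    exact mul_ne_zero hΓ1 hΓ2
  have hgm : AEMeasurable g μ :=
    (hgc.mono Ioo_subset_Icc_self).aemeasurable measurableSet_Ioo
  have hgm' : AEMeasurable g' μ :=
    (hg'.mono Ioo_subset_Icc_self).aemeasurable measurableSet_Ioo
  have hfi : Integrable (fun s ↦ g' s * f s) μ :=
    ((hg'.mul hf).integrableOn_Icc).mono_set Ioo_subset_Icc_self
  have hkm : AEMeasurable (Function.uncurry k) (μ.prod μ) := by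
    have h1 : AEMeasurable (fun z : ℝ × ℝ ↦
        (g x - g z.1) ^ (1 - al - 1) * g' z.1 * (g z.1 - g z.2) ^ (al - 1)) (μ.prod μ) :=
      (((hgm.comp_fst.const_sub _).pow_const _).mul hgm'.comp_fst).mul
        ((hgm.comp_fst.sub hgm.comp_snd).pow_const _)
    exact h1.indicator (measurableSet_lt measurable_snd measurable_fst)
  have hint : Integrable (Function.uncurry fun t s ↦ k t s * (g' s * f s)) (μ.prod μ) := by
    refine (integrable_prod_iff' ?_).2 ⟨?_, ?_⟩
    · exact hkm.aestronglyMeasurable.mul hfi.aestronglyMeasurable.comp_snd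
    · exact ae_restrict_of_forall_mem measurableSet_Ioo fun s hs ↦
        (hk_integrable s hs).mul_const (g' s * f s)
    · refine (hfi.norm.const_mul B).congr ?_
      refine ae_restrict_of_forall_mem measurableSet_Ioo fun s hs ↦ ?_
      simp only [Function.uncurry, norm_mul]
      rw [integral_mul_const, ← hk_int s hs]
      congr 1
      refine setIntegral_congr_fun measurableSet_Ioo fun t ht ↦ ?_
      exact (Real.norm_of_nonneg (hk_nonneg s hs t ht)).symm
  have hinner : ∀ t ∈ Ioo a x, ((g x - g t) ^ (1 - al - 1) * g' t) • fracInt a al g g' f t =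
      (Real.Gamma al)⁻¹ * ∫ s, k t s * (g' s * f s) ∂μ := by
    intro t ht
    have h1 : ∀ s, k t s * (g' s * f s) = (Iio t).indicator (fun s ↦
        (g x - g t) ^ (1 - al - 1) * g' t * (((g t - g s) ^ (al - 1) * g' s) * f s)) s := by
      intro s
      simp only [k, indicator, mem_Iio]
      split_ifs <;> ring
    simp only [h1, μ]
    rw [setIntegral_indicator measurableSet_Iio,
      show Ioo a x ∩ Iio t = Ioo a t by ext s; simp; grind [ht.2], integral_const_mul,
      fracInt, intervalIntegral.integral_of_le ht.1.le, integral_Ioc_eq_integral_Ioo]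
    simp only [smul_eq_mul]
    ring
  have houter : ∫ t, ∫ s, k t s * (g' s * f s) ∂μ ∂μ = B * ∫ s, g' s * f s ∂μ := by
    rw [integral_integral_swap hint, ← integral_const_mul]
    refine setIntegral_congr_fun measurableSet_Ioo fun s hs ↦ ?_
    rw [integral_mul_const, hk_int s hs]
  rw [fracInt, intervalIntegral.integral_of_le hax, integral_Ioc_eq_integral_Ioo,
    setIntegral_congr_fun measurableSet_Ioo hinner, integral_const_mul, houter,
    intervalIntegral.integral_of_le hax, integral_Ioc_eq_integral_Ioo, hB, smul_eq_mul]
  field_simp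
  rfl

/-- Fundamental theorem of Riemann–Liouville fractional calculus with
respect to a function: `(_{RL}D_{a+}^{α,g}(I_{a+}^{α,g} f))(x) = f(x)`. -/
theorem statement19 (a b al : ℝ) (hab : a < b) (hal : al ∈ Ioo (0:ℝ) 1)
    (g g' : ℝ → ℝ)
    (hg1 : ∀ t ∈ Icc a b, HasDerivWithinAt g (g' t) (Icc a b) t)
    (hg2 : ContinuousOn g' (Icc a b))
    (hgpos : ∀ t ∈ Icc a b, 0 < g' t)
    (f : ℝ → ℝ) (hf : ContinuousOn f (Icc a b))
    (x : ℝ) (hx : x ∈ Ioc a b) :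
    DifferentiableWithinAt ℝ
      (fracInt a (1 - al) g g' (fracInt a al g g' f)) (Icc a b) x ∧
    (g' x)⁻¹ * derivWithin
      (fracInt a (1 - al) g g' (fracInt a al g g' f)) (Icc a b) x = f x := by
  have key : ∀ y ∈ Icc a b, fracInt a (1 - al) g g' (fracInt a al g g' f) y =
      ∫ t in a..y, g' t * f t := fun y hy ↦ by
    have hsub : Icc a y ⊆ Icc a b := Icc_subset_Icc_right hy.2
    exact fracInt_one_sub_fracInt hy.1 hal (fun t ht ↦ (hg1 t (hsub ht)).mono hsub)
      (hg2.mono hsub) (fun t ht ↦ hgpos t (hsub ht)) (hf.mono hsub)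
  have hx' : x ∈ Icc a b := Ioc_subset_Icc_self hx
  have hc : ContinuousOn (fun t ↦ g' t * f t) (Icc a b) := hg2.mul hf
  have hF : HasDerivWithinAt (fun y ↦ ∫ t in a..y, g' t * f t) (g' x * f x) (Icc a b) x := by
    have : Fact (x ∈ Icc a b) := ⟨hx'⟩
    refine intervalIntegral.integral_hasDerivWithinAt_right (t := Icc a b) ?_
      (hc.stronglyMeasurableAtFilter_nhdsWithin measurableSet_Icc x) (hc x hx')
    exact (hc.mono (Icc_subset_Icc_right hx.2)).intervalIntegrable_of_Icc hx.1.le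
  have hD := hF.congr key (key x hx')
  refine ⟨hD.differentiableWithinAt, ?_⟩
  rw [hD.derivWithin (uniqueDiffOn_Icc hab x hx'), inv_mul_cancel_left₀ (hgpos x hx').ne']
end
end
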